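/- arXiv:2407.16055 — 3 statements merged into one kernel-verified Lean document; each statement's English description precedes it below -/
import Mathlib

section
/- Let m = ∏_{i=1}^r m_i and n = ∏_{i=1}^r n_i, and set k_i = min(m_i, n_i) and k = ∏_{i=1}^r k_i. An m × n complex matrix M can be factored as M = A (M₁ ⊗ ⋯ ⊗ M_r) B*, where A is an m × m unitary, B is an n × n unitary, and each M_i is an m_i × n_i complex matrix, if and only if there exist nonnegative real numbers σ_{i,j} (1 ≤ i ≤ r, 1 ≤ j ≤ k_i) such that the multiset of nonzero singular values of M is contained in, and accounted for by, the k products σ_{1,j₁} σ_{2,j₂} ⋯ σ_{r,j_r} over (j₁,…,j_r) ∈ ∏_i {1,…,k_i}; that is, the multiset of singular values of M, padded with zeros to size k, equals the multiset of these products. -/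
open Matrix

/-- The multiset of singular values of a complex matrix `M`: the nonnegative square roots of
the eigenvalues of `Mᴴ * M`, counted with multiplicity. -/
noncomputable def singularValues {m n : Type*} [Fintype m] [Fintype n] [DecidableEq n]
    (M : Matrix m n ℂ) : Multiset ℝ :=
  Multiset.map (fun j => Real.sqrt ((Matrix.isHermitian_conjTranspose_mul_self M).eigenvalues j))
    Finset.univ.val

/-- The Kronecker (tensor) product of a family of matrices `M i : Matrix (Fin (m i)) (Fin (n i)) ℂ`,
as a matrix indexed by the product index types. -/
def kronFamily {r : ℕ} {m n : Fin r → ℕ} (M : ∀ i, Matrix (Fin (m i)) (Fin (n i)) ℂ) :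
    Matrix (∀ i, Fin (m i)) (∀ i, Fin (n i)) ℂ :=
  fun a b => ∏ i, M i (a i) (b i)

theorem hk_polar {m n : Type*} [Fintype m] [Fintype n] [DecidableEq m] [DecidableEq n]
    (M N : Matrix m n ℂ) (h : Mᴴ * M = Nᴴ * N) :
    ∃ A : Matrix.unitaryGroup m ℂ, M = (A : Matrix m m ℂ) * N := by
  have hnorm : ∀ x, ‖toEuclideanLin M x‖ = ‖toEuclideanLin N x‖ := by
    intro x
    have key : ∀ K : Matrix m n ℂ, inner ℂ (toEuclideanLin K x) (toEuclideanLin K x)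
        = inner ℂ x (toEuclideanLin (Kᴴ * K) x) := by
      intro K
      rw [← LinearMap.adjoint_inner_right, ← Matrix.toEuclideanLin_conjTranspose_eq_adjoint]
      congr 1
      simp [Matrix.toLpLin_apply, Matrix.mulVec_mulVec]
    have h2 : inner ℂ (toEuclideanLin M x) (toEuclideanLin M x)
        = inner ℂ (toEuclideanLin N x) (toEuclideanLin N x) := by
      rw [key, key, h]
    rw [inner_self_eq_norm_sq_to_K, inner_self_eq_norm_sq_to_K] at h2
    have h3 : ‖toEuclideanLin M x‖ ^ 2 = ‖toEuclideanLin N x‖ ^ 2 := by exact_mod_cast h2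
    exact (sq_eq_sq₀ (norm_nonneg _) (norm_nonneg _)).1 h3
  obtain ⟨s, hs⟩ := LinearMap.exists_rightInverse_of_surjective
    (toEuclideanLin N).rangeRestrict (LinearMap.range_rangeRestrict _)
  have hs' : ∀ y, toEuclideanLin N (s y) = y := fun y => by
    have := LinearMap.congr_fun hs y
    exact congrArg Subtype.val this
  let L : LinearMap.range (toEuclideanLin N) →ₗᵢ[ℂ] EuclideanSpace ℂ m :=
    ⟨(toEuclideanLin M) ∘ₗ s, fun y => by
      rw [LinearMap.comp_apply, hnorm, hs']; rfl⟩
  have hL : ∀ x, L.extend (toEuclideanLin N x) = toEuclideanLin M x := by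
    intro x
    have h1 := L.extend_apply ⟨toEuclideanLin N x, LinearMap.mem_range_self _ x⟩
    rw [h1]
    change toEuclideanLin M (s _) = _
    rw [← sub_eq_zero, ← map_sub, ← norm_eq_zero, hnorm, map_sub, hs']
    simp
  let A : Matrix m m ℂ := toEuclideanLin.symm L.extend.toLinearMap
  have hA : toEuclideanLin A = L.extend.toLinearMap := LinearEquiv.apply_symm_apply _ _
  have hAu : A ∈ Matrix.unitaryGroup m ℂ := by
    rw [Matrix.mem_unitaryGroup_iff', Matrix.star_eq_conjTranspose]
    apply toEuclideanLin.injective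
    ext1 x
    refine ext_inner_left ℂ fun v => ?_
    have : toEuclideanLin (Aᴴ * A) x = toEuclideanLin Aᴴ (toEuclideanLin A x) := by
      simp [Matrix.toLpLin_apply, Matrix.mulVec_mulVec]
    rw [this, Matrix.toEuclideanLin_conjTranspose_eq_adjoint, LinearMap.adjoint_inner_right, hA]
    simp
  refine ⟨⟨A, hAu⟩, ?_⟩
  apply toEuclideanLin.injective
  ext1 x
  have : toEuclideanLin (A * N) x = toEuclideanLin A (toEuclideanLin N x) := by
    simp [Matrix.toLpLin_apply, Matrix.mulVec_mulVec]
  change _ = toEuclideanLin (A * N) x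
  rw [this, hA]
  exact (hL x).symm

open ComplexOrder in
theorem hk_charpoly_eq {m n : Type*} [Fintype m] [Fintype n] [DecidableEq n]
    (M N : Matrix m n ℂ) (h : singularValues M = singularValues N) :
    (Mᴴ * M).charpoly = (Nᴴ * N).charpoly := by
  have key : ∀ K : Matrix m n ℂ, (Kᴴ * K).charpoly =
      ((singularValues K).map (fun x : ℝ => Polynomial.X - Polynomial.C ((x ^ 2 : ℝ) : ℂ))).prod := by
    intro K
    rw [(Matrix.isHermitian_conjTranspose_mul_self K).charpoly_eq, singularValues,
      Multiset.map_map, Finset.prod]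
    congr 1
    apply Multiset.map_congr rfl
    intro x _
    have := (Matrix.posSemidef_conjTranspose_mul_self K).eigenvalues_nonneg x
    simp only [Function.comp_apply]
    rw [Real.sq_sqrt this]
    rfl
  rw [key, key, h]

theorem hk_sv_of_charpoly_eq {m n : Type*} [Fintype m] [Fintype n] [DecidableEq n]
    (M N : Matrix m n ℂ) (h : (Mᴴ * M).charpoly = (Nᴴ * N).charpoly) :
    singularValues M = singularValues N := by
  have := ((Matrix.isHermitian_conjTranspose_mul_self M).eigenvalues_eq_eigenvalues_iff
    (Matrix.isHermitian_conjTranspose_mul_self N)).2 h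
  rw [singularValues, singularValues, this]

theorem hk_sv_eq_iff {m n : Type*} [Fintype m] [Fintype n] [DecidableEq m] [DecidableEq n]
    (M N : Matrix m n ℂ) : singularValues M = singularValues N ↔
      ∃ A : Matrix.unitaryGroup m ℂ, ∃ B : Matrix.unitaryGroup n ℂ,
        M = (A : Matrix m m ℂ) * N * (B : Matrix n n ℂ)ᴴ := by
  constructor
  · intro h
    have hc := hk_charpoly_eq M N h
    have he := ((Matrix.isHermitian_conjTranspose_mul_self M).eigenvalues_eq_eigenvalues_iff
      (Matrix.isHermitian_conjTranspose_mul_self N)).2 hc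
    have h1 := (Matrix.isHermitian_conjTranspose_mul_self M).spectral_theorem
    have h2 := (Matrix.isHermitian_conjTranspose_mul_self N).spectral_theorem
    rw [he] at h1
    set U := (Matrix.isHermitian_conjTranspose_mul_self M).eigenvectorUnitary
    set V := (Matrix.isHermitian_conjTranspose_mul_self N).eigenvectorUnitary
    set D : Matrix n n ℂ := diagonal
      (RCLike.ofReal ∘ (Matrix.isHermitian_conjTranspose_mul_self N).eigenvalues)
    rw [Unitary.conjStarAlgAut_apply] at h1 h2
    let B : Matrix.unitaryGroup n ℂ := U * star V
    have hV : star (V : Matrix n n ℂ) * (V : Matrix n n ℂ) = 1 := Unitary.coe_star_mul_self V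
    have hB : Mᴴ * M = (N * (B : Matrix n n ℂ)ᴴ)ᴴ * (N * (B : Matrix n n ℂ)ᴴ) := by
      have hBc : (B : Matrix n n ℂ) = (U : Matrix n n ℂ) * star (V : Matrix n n ℂ) := rfl
      have e : (N * (B : Matrix n n ℂ)ᴴ)ᴴ * (N * (B : Matrix n n ℂ)ᴴ)
          = (B : Matrix n n ℂ) * (Nᴴ * N) * (B : Matrix n n ℂ)ᴴ := by
        simp [Matrix.conjTranspose_mul, Matrix.mul_assoc]
      rw [e, h1, h2, hBc]
      simp only [← Matrix.star_eq_conjTranspose, star_mul, star_star]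
      calc (U : Matrix n n ℂ) * D * star (U : Matrix n n ℂ)
          = (U : Matrix n n ℂ) * 1 * D * 1 * star (U : Matrix n n ℂ) := by simp
        _ = _ := by rw [← hV]; simp only [Matrix.mul_assoc]
    obtain ⟨A, hA⟩ := hk_polar _ _ hB
    exact ⟨A, B, by rw [hA, Matrix.mul_assoc]⟩
  · rintro ⟨A, B, rfl⟩
    apply hk_sv_of_charpoly_eq
    have hA : (A : Matrix m m ℂ)ᴴ * (A : Matrix m m ℂ) = 1 := Unitary.coe_star_mul_self A
    have hB : (B : Matrix n n ℂ)ᴴ * (B : Matrix n n ℂ) = 1 := Unitary.coe_star_mul_self B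
    have e : ((A : Matrix m m ℂ) * N * (B : Matrix n n ℂ)ᴴ)ᴴ * ((A : Matrix m m ℂ) * N * (B : Matrix n n ℂ)ᴴ)
        = (B : Matrix n n ℂ) * (Nᴴ * N * (B : Matrix n n ℂ)ᴴ) := by
      calc _ = (B : Matrix n n ℂ) * (Nᴴ * ((A : Matrix m m ℂ)ᴴ * (A : Matrix m m ℂ)) * N * (B : Matrix n n ℂ)ᴴ) := by
            simp [Matrix.conjTranspose_mul, Matrix.mul_assoc]
        _ = _ := by rw [hA]; simp
    rw [e, Matrix.charpoly_mul_comm, Matrix.mul_assoc, hB, Matrix.mul_one]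

/-- Rectangular generalized diagonal matrix. -/
noncomputable def hkDiag {m n κ : Type*} [DecidableEq m] [DecidableEq n] [Fintype κ]
    (f : κ → m) (g : κ → n) (s : κ → ℝ) : Matrix m n ℂ :=
  fun a b => ∑ J, if f J = a ∧ g J = b then (s J : ℂ) else 0

theorem hkDiag_gram {m n κ : Type*} [Fintype m] [Fintype n] [DecidableEq m] [DecidableEq n]
    [Fintype κ] [DecidableEq κ] (f : κ → m) (g : κ → n) (s : κ → ℝ)
    (hf : Function.Injective f) :
    (hkDiag f g s)ᴴ * hkDiag f g s =
      diagonal (fun b => ((∑ J, if g J = b then s J ^ 2 else 0 : ℝ) : ℂ)) := by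
  ext b c
  rw [Matrix.mul_apply]
  simp only [conjTranspose_apply, hkDiag, star_sum, Finset.sum_mul_sum, apply_ite star, star_zero]
  rw [Finset.sum_comm]
  have h1 : ∀ J : κ, (∑ a : m, ∑ J' : κ,
      (if f J = a ∧ g J = b then star (s J : ℂ) else 0) *
        (if f J' = a ∧ g J' = c then (s J' : ℂ) else 0)) =
      if g J = b ∧ g J = c then ((s J ^ 2 : ℝ) : ℂ) else 0 := by
    intro J
    rw [Finset.sum_eq_single (f J), Finset.sum_eq_single J]
    · by_cases hb : g J = b <;> by_cases hc : g J = c <;> simp [hb, hc, pow_two]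
    · intro J' _ hne
      simp [hf.ne hne]
    · simp
    · intro a _ hne
      simp [hne.symm]
    · simp
  rw [Finset.sum_congr rfl (fun J _ => h1 J)]
  rw [diagonal_apply]
  split_ifs with hbc
  · subst hbc
    simp only [and_self]
    push_cast
    apply Finset.sum_congr rfl
    intro J _
    split_ifs <;> simp
  · apply Finset.sum_eq_zero
    intro J _
    rw [if_neg]
    rintro ⟨rfl, rfl⟩
    exact hbc rfl

theorem hkDiag_sv {m n κ : Type*} [Fintype m] [Fintype n] [DecidableEq m] [DecidableEq n]
    [Fintype κ] [DecidableEq κ] (f : κ → m) (g : κ → n) (s : κ → ℝ)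
    (hf : Function.Injective f) (hg : Function.Injective g) (hs : ∀ J, 0 ≤ s J) :
    Multiset.filter (fun x => x ≠ 0) (singularValues (hkDiag f g s)) =
      Multiset.filter (fun x => x ≠ 0) (Multiset.map s Finset.univ.val) := by
  set d : n → ℝ := fun b => ∑ J, if g J = b then s J ^ 2 else 0 with hd
  have hdg : ∀ J, d (g J) = s J ^ 2 := by
    intro J
    simp [hd, hg.eq_iff]
  have h1 := (Matrix.isHermitian_conjTranspose_mul_self (hkDiag f g s)).roots_charpoly_eq_eigenvalues
  have h0 : ((hkDiag f g s)ᴴ * hkDiag f g s).charpoly.roots =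
      Multiset.map (fun b => ((d b : ℝ) : ℂ)) Finset.univ.val := by
    rw [hkDiag_gram f g s hf, Matrix.charpoly_diagonal]
    change (∏ b, (Polynomial.X - Polynomial.C ((d b : ℝ) : ℂ))).roots = _
    clear_value d
    rw [Polynomial.roots_prod]
    · simp
    · simp [Finset.prod_ne_zero_iff, Polynomial.X_sub_C_ne_zero]
  rw [h0] at h1
  have h2 : Multiset.map d Finset.univ.val = Multiset.map
      (Matrix.isHermitian_conjTranspose_mul_self (hkDiag f g s)).eigenvalues Finset.univ.val := by
    have := congrArg (Multiset.map Complex.re) h1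
    simpa [Multiset.map_map, Function.comp_def] using this
  have h3 : singularValues (hkDiag f g s) =
      Multiset.map (fun b => Real.sqrt (d b)) Finset.univ.val := by
    have := congrArg (Multiset.map Real.sqrt) h2
    rw [Multiset.map_map, Multiset.map_map] at this
    exact this.symm
  rw [h3, Multiset.filter_map, Multiset.filter_map]
  have h4 : Finset.univ.filter ((fun x => x ≠ 0) ∘ fun b => Real.sqrt (d b)) =
      (Finset.univ.filter ((fun x => x ≠ 0) ∘ s)).map ⟨g, hg⟩ := by
    ext b
    simp only [Finset.mem_filter, Finset.mem_univ, true_and, Function.comp_apply, Finset.mem_map,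
      Function.Embedding.coeFn_mk]
    constructor
    · intro hb
      have : d b ≠ 0 := fun h => hb (by simp [h])
      obtain ⟨J, -, hJ⟩ := Finset.exists_ne_zero_of_sum_ne_zero this
      have hJb : g J = b := by
        by_contra hh
        exact hJ (if_neg hh)
      refine ⟨J, fun h0 => hJ ?_, hJb⟩
      simp [h0]
    · rintro ⟨J, hJ, rfl⟩
      rw [hdg, Real.sqrt_sq (hs J)]
      exact hJ
  have h5 := congrArg Finset.val h4
  rw [Finset.filter_val, Finset.map_val, Finset.filter_val] at h5
  rw [h5, Multiset.map_map]
  apply Multiset.map_congr rfl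
  intro J _
  change Real.sqrt (d (g J)) = _
  rw [hdg, Real.sqrt_sq (hs J)]

theorem hk_filter_add (t : Multiset ℝ) :
    Multiset.filter (fun x => x ≠ 0) t +
      Multiset.replicate (Multiset.card t - Multiset.card (Multiset.filter (fun x => x ≠ 0) t)) 0
      = t := by
  have h := Multiset.filter_add_not (fun x : ℝ => x ≠ 0) t
  have hc := congrArg Multiset.card h
  rw [Multiset.card_add] at hc
  have h2 : Multiset.filter (fun x : ℝ => ¬ x ≠ 0) t = Multiset.replicate
      (Multiset.card (Multiset.filter (fun x : ℝ => ¬ x ≠ 0) t)) 0 := by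
    rw [Multiset.eq_replicate]
    refine ⟨rfl, fun b hb => ?_⟩
    simpa using (Multiset.mem_filter.1 hb).2
  have h3 : Multiset.card t - Multiset.card (Multiset.filter (fun x => x ≠ 0) t) =
      Multiset.card (Multiset.filter (fun x : ℝ => ¬ x ≠ 0) t) := by omega
  rw [h3, ← h2, h]

theorem hk_eq_of_filter (t u : Multiset ℝ) (hc : Multiset.card t = Multiset.card u)
    (h : Multiset.filter (fun x => x ≠ 0) t = Multiset.filter (fun x => x ≠ 0) u) : t = u := by
  rw [← hk_filter_add t, ← hk_filter_add u, hc, h]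

theorem hk_sv_card {m n : Type*} [Fintype m] [Fintype n] [DecidableEq n] (M : Matrix m n ℂ) :
    Multiset.card (singularValues M) = Fintype.card n := by
  simp [singularValues]

theorem hk_sv_nonneg {m n : Type*} [Fintype m] [Fintype n] [DecidableEq n] (M : Matrix m n ℂ) :
    ∀ x ∈ singularValues M, 0 ≤ x := by
  intro x hx
  obtain ⟨j, -, rfl⟩ := Multiset.mem_map.1 hx
  exact Real.sqrt_nonneg _

open ComplexOrder in
theorem hk_sv_rank {m n : Type*} [Fintype m] [Fintype n] [DecidableEq n] (M : Matrix m n ℂ) :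
    Multiset.card (Multiset.filter (fun x => x ≠ 0) (singularValues M)) = M.rank := by
  rw [← Matrix.rank_conjTranspose_mul_self,
    (Matrix.isHermitian_conjTranspose_mul_self M).rank_eq_card_non_zero_eigs, singularValues,
    Multiset.filter_map, Multiset.card_map, Fintype.card_subtype]
  rw [Finset.card_def, Finset.filter_val]
  congr 1
  apply Multiset.filter_congr
  intro x _
  have := (Matrix.posSemidef_conjTranspose_mul_self M).eigenvalues_nonneg x
  simp [Real.sqrt_eq_zero this]

theorem hk_exists_fun (t : Multiset ℝ) (k : ℕ) (h : Multiset.card t = k) :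
    ∃ s : Fin k → ℝ, Multiset.map s Finset.univ.val = t := by
  subst h
  induction t using Quotient.inductionOn with
  | _ l =>
    refine ⟨fun i => l.get i, ?_⟩
    rw [Fin.univ_val_map]
    exact congrArg _ (List.ofFn_get l)

theorem hk_svd_fin {m n : ℕ} (M : Matrix (Fin m) (Fin n) ℂ) :
    ∃ s : Fin (min m n) → ℝ, (∀ j, 0 ≤ s j) ∧
      ∃ A : Matrix.unitaryGroup (Fin m) ℂ, ∃ B : Matrix.unitaryGroup (Fin n) ℂ,
        M = (A : Matrix (Fin m) (Fin m) ℂ) * hkDiag (Fin.castLE (min_le_left m n))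
          (Fin.castLE (min_le_right m n)) s * (B : Matrix (Fin n) (Fin n) ℂ)ᴴ := by
  set t := Multiset.filter (fun x => x ≠ 0) (singularValues M) with ht
  have hr : Multiset.card t ≤ min m n := by
    rw [ht, hk_sv_rank]
    refine le_min ?_ ?_
    · simpa using M.rank_le_card_height
    · simpa using M.rank_le_card_width
  obtain ⟨s, hs⟩ := hk_exists_fun (t + Multiset.replicate (min m n - Multiset.card t) 0) (min m n)
    (by simp; omega)
  have hs0 : ∀ j, 0 ≤ s j := by
    intro j
    have : s j ∈ t + Multiset.replicate (min m n - Multiset.card t) 0 := by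
      rw [← hs]; exact Multiset.mem_map_of_mem _ (Finset.mem_univ j)
    rcases Multiset.mem_add.1 this with h | h
    · exact hk_sv_nonneg M _ (Multiset.mem_filter.1 h).1
    · exact (Multiset.eq_of_mem_replicate h).ge
  refine ⟨s, hs0, (hk_sv_eq_iff _ _).1 ?_⟩
  apply hk_eq_of_filter
  · rw [hk_sv_card, hk_sv_card]
  · rw [hkDiag_sv _ _ _ (Fin.castLE_injective _) (Fin.castLE_injective _) hs0, hs,
      Multiset.filter_add]
    have h0 : Multiset.filter (fun x : ℝ => x ≠ 0)
        (Multiset.replicate (min m n - Multiset.card t) 0) = 0 := by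
      rw [Multiset.filter_eq_nil]
      intro a ha
      simpa using Multiset.eq_of_mem_replicate ha
    rw [h0, add_zero, ht, Multiset.filter_filter]
    simp

theorem hk_kron_mul {r : ℕ} {l m n : Fin r → ℕ} (A : ∀ i, Matrix (Fin (l i)) (Fin (m i)) ℂ)
    (B : ∀ i, Matrix (Fin (m i)) (Fin (n i)) ℂ) :
    kronFamily (fun i => A i * B i) = kronFamily A * kronFamily B := by
  ext a b
  simp only [kronFamily, Matrix.mul_apply, Finset.prod_univ_sum, Fintype.piFinset_univ,
    Finset.prod_mul_distrib]

theorem hk_kron_star {r : ℕ} {m n : Fin r → ℕ} (A : ∀ i, Matrix (Fin (m i)) (Fin (n i)) ℂ) :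
    kronFamily (fun i => (A i)ᴴ) = (kronFamily A)ᴴ := by
  ext a b
  simp [kronFamily, Matrix.conjTranspose_apply]

theorem hk_kron_one {r : ℕ} {m : Fin r → ℕ} :
    kronFamily (fun i => (1 : Matrix (Fin (m i)) (Fin (m i)) ℂ)) = 1 := by
  ext a b
  simp only [kronFamily, Matrix.one_apply, Fintype.prod_ite_zero, Finset.prod_const_one,
    funext_iff]

theorem hk_kron_unitary {r : ℕ} {m : Fin r → ℕ} (A : ∀ i, Matrix.unitaryGroup (Fin (m i)) ℂ) :
    kronFamily (fun i => (A i : Matrix (Fin (m i)) (Fin (m i)) ℂ)) ∈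
      Matrix.unitaryGroup (∀ i, Fin (m i)) ℂ := by
  rw [Matrix.mem_unitaryGroup_iff', Matrix.star_eq_conjTranspose, ← hk_kron_star, ← hk_kron_mul,
    ← hk_kron_one]
  congr 1
  funext i
  exact Unitary.coe_star_mul_self (A i)

theorem hk_kron_diag {r : ℕ} {m n k : Fin r → ℕ} (f : ∀ i, Fin (k i) → Fin (m i))
    (g : ∀ i, Fin (k i) → Fin (n i)) (s : ∀ i, Fin (k i) → ℝ) :
    kronFamily (fun i => hkDiag (f i) (g i) (s i)) =
      hkDiag (fun (J : ∀ i, Fin (k i)) i => f i (J i)) (fun J i => g i (J i))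
        (fun J => ∏ i, s i (J i)) := by
  ext a b
  simp only [kronFamily, hkDiag, Finset.prod_univ_sum, Fintype.piFinset_univ,
    Fintype.prod_ite_zero, funext_iff, forall_and, Complex.ofReal_prod]

/-- A matrix `M` of size `(∏ mᵢ) × (∏ nᵢ)` factors as `A (M₁ ⊗ ⋯ ⊗ M_r) Bᴴ` with `A`, `B`
unitary iff there are nonnegative reals `σ i j` (`j < kᵢ = min mᵢ nᵢ`) such that the multiset
of singular values of `M`, padded with zeros to size `k = ∏ kᵢ`, equals the multiset of the
products `σ 1 j₁ ⋯ σ r j_r`. -/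
theorem kron_factorization_iff_singularValues {r : ℕ} (m n : Fin r → ℕ)
    (M : Matrix (∀ i, Fin (m i)) (∀ i, Fin (n i)) ℂ) :
    (∃ A : Matrix.unitaryGroup (∀ i, Fin (m i)) ℂ,
     ∃ B : Matrix.unitaryGroup (∀ i, Fin (n i)) ℂ,
     ∃ Ms : ∀ i, Matrix (Fin (m i)) (Fin (n i)) ℂ,
        M = (A : Matrix (∀ i, Fin (m i)) (∀ i, Fin (m i)) ℂ) * kronFamily Ms *
          ((B : Matrix (∀ i, Fin (n i)) (∀ i, Fin (n i)) ℂ))ᴴ) ↔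
    (∃ σ : ∀ i, Fin (min (m i) (n i)) → ℝ, (∀ i j, 0 ≤ σ i j) ∧
      Multiset.filter (fun x => x ≠ 0) (singularValues M) +
        Multiset.replicate ((∏ i, min (m i) (n i)) -
          Multiset.card (Multiset.filter (fun x => x ≠ 0) (singularValues M))) (0 : ℝ) =
      Multiset.map (fun J : ∀ i, Fin (min (m i) (n i)) => ∏ i, σ i (J i))
        Finset.univ.val) := by
  have hf : Function.Injective (fun (J : ∀ i, Fin (min (m i) (n i))) i =>
      Fin.castLE (min_le_left (m i) (n i)) (J i)) := fun J J' h => funext fun i =>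
    Fin.castLE_injective _ (congrFun h i)
  have hg : Function.Injective (fun (J : ∀ i, Fin (min (m i) (n i))) i =>
      Fin.castLE (min_le_right (m i) (n i)) (J i)) := fun J J' h => funext fun i =>
    Fin.castLE_injective _ (congrFun h i)
  have hcard : ∀ σ : ∀ i, Fin (min (m i) (n i)) → ℝ, Multiset.card
      (Multiset.map (fun J : ∀ i, Fin (min (m i) (n i)) => ∏ i, σ i (J i)) Finset.univ.val) =
      ∏ i, min (m i) (n i) := by
    intro σ
    rw [Multiset.card_map, ← Finset.card_def, Finset.card_univ, Fintype.card_pi]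
    simp
  constructor
  · rintro ⟨A, B, Ms, rfl⟩
    choose σ hσ U V hUV using fun i => hk_svd_fin (Ms i)
    refine ⟨σ, hσ, ?_⟩
    have h1 : kronFamily Ms = kronFamily (fun i => (U i : Matrix (Fin (m i)) (Fin (m i)) ℂ)) *
        hkDiag (fun (J : ∀ i, Fin (min (m i) (n i))) i => Fin.castLE (min_le_left (m i) (n i)) (J i))
          (fun J i => Fin.castLE (min_le_right (m i) (n i)) (J i)) (fun J => ∏ i, σ i (J i)) *
        (kronFamily (fun i => (V i : Matrix (Fin (n i)) (Fin (n i)) ℂ)))ᴴ := by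
      rw [← hk_kron_diag, ← hk_kron_star, ← hk_kron_mul, ← hk_kron_mul]
      congr 1
      funext i
      exact hUV i
    have h2 := (hk_sv_eq_iff _ _).2 ⟨⟨_, hk_kron_unitary U⟩, ⟨_, hk_kron_unitary V⟩, h1⟩
    have h3 := (hk_sv_eq_iff _ (kronFamily Ms)).2 ⟨A, B, rfl⟩
    rw [h3, h2, hkDiag_sv _ _ _ hf hg (fun J => Finset.prod_nonneg fun i _ => hσ i _), ← hcard σ]
    exact hk_filter_add _
  · rintro ⟨σ, hσ, h⟩
    have h1 : singularValues M = singularValues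
        (kronFamily (fun i => hkDiag (Fin.castLE (min_le_left (m i) (n i)))
          (Fin.castLE (min_le_right (m i) (n i))) (σ i))) := by
      apply hk_eq_of_filter
      · rw [hk_sv_card, hk_sv_card]
      · rw [hk_kron_diag,
          hkDiag_sv _ _ _ hf hg (fun J => Finset.prod_nonneg fun i _ => hσ i _), ← h,
          Multiset.filter_add, Multiset.filter_filter]
        have h0 : ∀ k : ℕ, Multiset.filter (fun x : ℝ => x ≠ 0) (Multiset.replicate k 0) = 0 := by
          intro k
          rw [Multiset.filter_eq_nil]
          intro a ha
          simpa using Multiset.eq_of_mem_replicate ha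
        rw [h0]
        simp
    obtain ⟨A, B, hAB⟩ := (hk_sv_eq_iff _ _).1 h1
    exact ⟨A, B, _, hAB⟩
end

section
/- Fix φ ∈ (0, π/4] and ε ∈ [0, 1]. Let T = ℂ² (top ancilla qubit) with orthonormal basis |0⟩, |1⟩, let I = ℂ² ⊗ I′ (input register whose first factor is the accept qubit) and A (lower ancilla register) be finite-dimensional complex inner product spaces, with a distinguished unit vector a₀ ∈ A. Let U be a unitary on I ⊗ A, let P₁ = (|1⟩⟨1| ⊗ 1_{I′}) ⊗ 1_A, and let H be the Hadamard unitary on T. Define unitaries on T ⊗ I ⊗ A: V = diag(e^{−iφ}, e^{iφ}) ⊗ 1_I ⊗ |a₀⟩⟨a₀| + e^{2iφ}·(1_T ⊗ 1_I ⊗ (1_A − |a₀⟩⟨a₀|)); Y = diag(e^{iφ}, e^{−iφ}) ⊗ (|1⟩⟨1| ⊗ 1_{I′}) ⊗ 1_A + 1_T ⊗ (|0⟩⟨0| ⊗ 1_{I′}) ⊗ 1_A; and Z = (H ⊗ 1)(1_T ⊗ U*) Y (1_T ⊗ U) V (H ⊗ 1). If ψ ∈ I is a unit vector with ‖P₁ U(ψ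 ⊗ a₀)‖² ≥ 1 − ε, then the unit vector Ψ = |0⟩ ⊗ ψ ⊗ a₀ satisfies ‖Z Ψ − Ψ‖ ≤ 2√ε. -/
open Matrix Kronecker

noncomputable section

/-- Euclidean (ℓ²) norm of a finitely supported complex vector. -/
def enormVec {ι : Type*} [Fintype ι] (v : ι → ℂ) : ℝ :=
  Real.sqrt (∑ i, ‖v i‖ ^ 2)

/-- The Hadamard unitary on `ℂ²`, sending `|0⟩ ↦ (|0⟩+|1⟩)/√2` and `|1⟩ ↦ (|0⟩−|1⟩)/√2`. -/
def Hadmat : Matrix (Fin 2) (Fin 2) ℂ :=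
  ((Real.sqrt 2 : ℝ) : ℂ)⁻¹ • !![1, 1; 1, -1]

/-- The diagonal operator on `ℂ²` with entries `a`, `b` in the basis `|0⟩`, `|1⟩`. -/
def diag2 (a b : ℂ) : Matrix (Fin 2) (Fin 2) ℂ :=
  Matrix.diagonal (fun t => if t = 0 then a else b)

/-- The rank-one projection `|a₀⟩⟨a₀|` onto the line spanned by `a₀`. -/
def projVec {ι : Type*} (a₀ : ι → ℂ) : Matrix ι ι ℂ :=
  Matrix.of fun x y => a₀ x * star (a₀ y)

/-- `P₁ = (|1⟩⟨1| ⊗ 1_{I′}) ⊗ 1_A`: projection onto accept-qubit value `1`. -/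
def P1mat (nI nA : ℕ) :
    Matrix ((Fin 2 × Fin nI) × Fin nA) ((Fin 2 × Fin nI) × Fin nA) ℂ :=
  (Matrix.single (1 : Fin 2) (1 : Fin 2) (1 : ℂ) ⊗ₖ (1 : Matrix (Fin nI) (Fin nI) ℂ))
    ⊗ₖ (1 : Matrix (Fin nA) (Fin nA) ℂ)

/-- `V = diag(e^{−iφ}, e^{iφ}) ⊗ 1_I ⊗ |a₀⟩⟨a₀| + e^{2iφ} (1_T ⊗ 1_I ⊗ (1_A − |a₀⟩⟨a₀|))`. -/
def Vmat (φ : ℝ) (nI nA : ℕ) (a₀ : Fin nA → ℂ) :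
    Matrix (Fin 2 × ((Fin 2 × Fin nI) × Fin nA)) (Fin 2 × ((Fin 2 × Fin nI) × Fin nA)) ℂ :=
  diag2 (Complex.exp (-(φ : ℂ) * Complex.I)) (Complex.exp ((φ : ℂ) * Complex.I)) ⊗ₖ
      ((1 : Matrix (Fin 2 × Fin nI) (Fin 2 × Fin nI) ℂ) ⊗ₖ projVec a₀) +
    Complex.exp (2 * (φ : ℂ) * Complex.I) •
      ((1 : Matrix (Fin 2) (Fin 2) ℂ) ⊗ₖ
        ((1 : Matrix (Fin 2 × Fin nI) (Fin 2 × Fin nI) ℂ) ⊗ₖ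
          ((1 : Matrix (Fin nA) (Fin nA) ℂ) - projVec a₀)))

/-- `Y = diag(e^{iφ}, e^{−iφ}) ⊗ (|1⟩⟨1| ⊗ 1_{I′}) ⊗ 1_A + 1_T ⊗ (|0⟩⟨0| ⊗ 1_{I′}) ⊗ 1_A`. -/
def Ymat (φ : ℝ) (nI nA : ℕ) :
    Matrix (Fin 2 × ((Fin 2 × Fin nI) × Fin nA)) (Fin 2 × ((Fin 2 × Fin nI) × Fin nA)) ℂ :=
  diag2 (Complex.exp ((φ : ℂ) * Complex.I)) (Complex.exp (-(φ : ℂ) * Complex.I)) ⊗ₖ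
      ((Matrix.single (1 : Fin 2) (1 : Fin 2) (1 : ℂ) ⊗ₖ
          (1 : Matrix (Fin nI) (Fin nI) ℂ)) ⊗ₖ (1 : Matrix (Fin nA) (Fin nA) ℂ)) +
    (1 : Matrix (Fin 2) (Fin 2) ℂ) ⊗ₖ
      ((Matrix.single (0 : Fin 2) (0 : Fin 2) (1 : ℂ) ⊗ₖ
          (1 : Matrix (Fin nI) (Fin nI) ℂ)) ⊗ₖ (1 : Matrix (Fin nA) (Fin nA) ℂ))

/-- `Z = (H ⊗ 1)(1_T ⊗ U*) Y (1_T ⊗ U) V (H ⊗ 1)`. -/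
def Zmat (φ : ℝ) (nI nA : ℕ) (a₀ : Fin nA → ℂ)
    (U : Matrix ((Fin 2 × Fin nI) × Fin nA) ((Fin 2 × Fin nI) × Fin nA) ℂ) :
    Matrix (Fin 2 × ((Fin 2 × Fin nI) × Fin nA)) (Fin 2 × ((Fin 2 × Fin nI) × Fin nA)) ℂ :=
  (Hadmat ⊗ₖ (1 : Matrix ((Fin 2 × Fin nI) × Fin nA) ((Fin 2 × Fin nI) × Fin nA) ℂ)) *
    ((1 : Matrix (Fin 2) (Fin 2) ℂ) ⊗ₖ Uᴴ) * Ymat φ nI nA *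
    ((1 : Matrix (Fin 2) (Fin 2) ℂ) ⊗ₖ U) * Vmat φ nI nA a₀ *
    (Hadmat ⊗ₖ (1 : Matrix ((Fin 2 × Fin nI) × Fin nA) ((Fin 2 × Fin nI) × Fin nA) ℂ))

end

noncomputable def tens {α β : Type*} (u : α → ℂ) (v : β → ℂ) : α × β → ℂ := fun p => u p.1 * v p.2

lemma kron_tens {α β : Type*} [Fintype α] [Fintype β] (A : Matrix α α ℂ) (B : Matrix β β ℂ)
    (u : α → ℂ) (v : β → ℂ) : (A ⊗ₖ B) *ᵥ (tens u v) = tens (A *ᵥ u) (B *ᵥ v) := by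
  ext p
  simp only [Matrix.mulVec, dotProduct, tens, Fintype.sum_prod_type, Finset.sum_mul_sum,
    Matrix.kroneckerMap_apply]
  refine Finset.sum_congr rfl fun i _ => Finset.sum_congr rfl fun j _ => by ring

lemma enormVec_sq {α : Type*} [Fintype α] (v : α → ℂ) : enormVec v ^ 2 = ∑ i, ‖v i‖ ^ 2 :=
  Real.sq_sqrt (Finset.sum_nonneg fun _ _ => by positivity)

lemma enormVec_nonneg {α : Type*} [Fintype α] (v : α → ℂ) : 0 ≤ enormVec v :=
  Real.sqrt_nonneg _

lemma enormVec_sq_dot {α : Type*} [Fintype α] (v : α → ℂ) :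
    ((enormVec v ^ 2 : ℝ) : ℂ) = star v ⬝ᵥ v := by
  rw [enormVec_sq]
  simp only [dotProduct, Pi.star_apply, RCLike.star_def, Complex.conj_mul', Complex.ofReal_sum,
    Complex.ofReal_pow]

lemma enormVec_tens {α β : Type*} [Fintype α] [Fintype β] (u : α → ℂ) (v : β → ℂ) :
    enormVec (tens u v) ^ 2 = enormVec u ^ 2 * enormVec v ^ 2 := by
  simp only [enormVec_sq, tens, Fintype.sum_prod_type, Finset.sum_mul_sum, norm_mul, mul_pow]

lemma enormVec_unitary {α : Type*} [Fintype α] [DecidableEq α] (W : Matrix α α ℂ)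
    (hW : Wᴴ * W = 1) (v : α → ℂ) : enormVec (W *ᵥ v) ^ 2 = enormVec v ^ 2 := by
  have : ((enormVec (W *ᵥ v) ^ 2 : ℝ) : ℂ) = ((enormVec v ^ 2 : ℝ) : ℂ) := by
    rw [enormVec_sq_dot, enormVec_sq_dot, Matrix.star_mulVec, ← Matrix.dotProduct_mulVec,
      Matrix.mulVec_mulVec, hW, Matrix.one_mulVec]
  exact_mod_cast this

noncomputable def P0mat (nI nA : ℕ) :
    Matrix ((Fin 2 × Fin nI) × Fin nA) ((Fin 2 × Fin nI) × Fin nA) ℂ :=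
  (Matrix.single (0 : Fin 2) (0 : Fin 2) (1 : ℂ) ⊗ₖ (1 : Matrix (Fin nI) (Fin nI) ℂ))
    ⊗ₖ (1 : Matrix (Fin nA) (Fin nA) ℂ)

lemma P1_apply (nI nA : ℕ) (w : (Fin 2 × Fin nI) × Fin nA → ℂ) (p) :
    (P1mat nI nA *ᵥ w) p = if p.1.1 = 1 then w p else 0 := by
  obtain ⟨⟨t, i⟩, j⟩ := p
  simp only [P1mat, Matrix.mulVec, dotProduct, Fintype.sum_prod_type,
    Matrix.kroneckerMap_apply, Matrix.one_apply, Fin.sum_univ_two]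
  fin_cases t <;> simp [Matrix.single_apply]

lemma P0_apply (nI nA : ℕ) (w : (Fin 2 × Fin nI) × Fin nA → ℂ) (p) :
    (P0mat nI nA *ᵥ w) p = if p.1.1 = 0 then w p else 0 := by
  obtain ⟨⟨t, i⟩, j⟩ := p
  simp only [P0mat, Matrix.mulVec, dotProduct, Fintype.sum_prod_type,
    Matrix.kroneckerMap_apply, Matrix.one_apply, Fin.sum_univ_two]
  fin_cases t <;> simp [Matrix.single_apply]

lemma P_add (nI nA : ℕ) (w : (Fin 2 × Fin nI) × Fin nA → ℂ) :
    P1mat nI nA *ᵥ w = w - P0mat nI nA *ᵥ w := by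
  ext p
  rw [Pi.sub_apply, P1_apply, P0_apply]
  obtain ⟨⟨t, i⟩, j⟩ := p
  fin_cases t <;> simp

lemma P_norm (nI nA : ℕ) (w : (Fin 2 × Fin nI) × Fin nA → ℂ) :
    enormVec (P1mat nI nA *ᵥ w) ^ 2 + enormVec (P0mat nI nA *ᵥ w) ^ 2 = enormVec w ^ 2 := by
  simp only [enormVec_sq, P1_apply, P0_apply, ← Finset.sum_add_distrib]
  refine Finset.sum_congr rfl fun p _ => ?_
  obtain ⟨⟨t, i⟩, j⟩ := p
  fin_cases t <;> simp

lemma projVec_self {n : ℕ} (a : Fin n → ℂ) (ha : enormVec a = 1) : projVec a *ᵥ a = a := by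
  have h := enormVec_sq_dot a
  rw [ha] at h
  ext i
  simp only [projVec, Matrix.mulVec, dotProduct, Matrix.of_apply, mul_assoc, ← Finset.mul_sum]
  simp only [dotProduct, Pi.star_apply] at h
  rw [← h]; simp

/-- diagonal phases -/
noncomputable def dvec (φ : ℝ) : Fin 2 → ℂ := fun t => ((Real.sqrt 2 : ℝ) : ℂ)⁻¹ *
  (if t = 0 then Complex.exp (-(φ : ℂ) * Complex.I) else Complex.exp ((φ : ℂ) * Complex.I))

noncomputable def e0 : Fin 2 → ℂ := fun t => if t = 0 then 1 else 0
noncomputable def hvec : Fin 2 → ℂ := fun _ => ((Real.sqrt 2 : ℝ) : ℂ)⁻¹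

lemma sqrt2_inv : (((Real.sqrt 2 : ℝ) : ℂ)⁻¹) * (((Real.sqrt 2 : ℝ) : ℂ)⁻¹) = 1 / 2 := by
  rw [← mul_inv, ← Complex.ofReal_mul, Real.mul_self_sqrt (by norm_num)]; norm_num

lemma H_e0 : Hadmat *ᵥ e0 = hvec := by
  ext t; fin_cases t <;> simp [Hadmat, e0, hvec, Matrix.mulVec, dotProduct, Fin.sum_univ_two]

lemma H_h : Hadmat *ᵥ hvec = e0 := by
  ext t
  fin_cases t <;> simp [Hadmat, e0, hvec, Matrix.mulVec, dotProduct, Fin.sum_univ_two]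
  have := sqrt2_inv
  linear_combination 2 * this

lemma diag_h (φ : ℝ) : diag2 (Complex.exp (-(φ : ℂ) * Complex.I))
    (Complex.exp ((φ : ℂ) * Complex.I)) *ᵥ hvec = dvec φ := by
  ext t; simp [diag2, hvec, dvec, Matrix.mulVec_diagonal, mul_comm]

lemma diag_d (φ : ℝ) : diag2 (Complex.exp ((φ : ℂ) * Complex.I))
    (Complex.exp (-(φ : ℂ) * Complex.I)) *ᵥ dvec φ = hvec := by
  have h : Complex.exp (-(φ : ℂ) * Complex.I) * Complex.exp ((φ : ℂ) * Complex.I) = 1 := by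
    rw [← Complex.exp_add]; simp
  ext t
  rw [diag2, Matrix.mulVec_diagonal]
  fin_cases t
  · simp only [dvec, hvec]; simp only [Fin.zero_eta, if_true]
    linear_combination ((Real.sqrt 2 : ℝ) : ℂ)⁻¹ * h
  · simp only [dvec, hvec]; simp only [Fin.mk_one, one_ne_zero, if_false]
    linear_combination ((Real.sqrt 2 : ℝ) : ℂ)⁻¹ * h

lemma norm_final (φ : ℝ) : enormVec (Hadmat *ᵥ dvec φ - e0) ^ 2 ≤ 4 := by
  have hs := sqrt2_inv
  have h0 : (Hadmat *ᵥ dvec φ - e0) 0 = ((Real.cos φ - 1 : ℝ) : ℂ) := by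
    simp [Hadmat, e0, dvec, Matrix.mulVec, dotProduct, Fin.sum_univ_two, Complex.cos]
    linear_combination (Complex.exp (-(φ * Complex.I)) + Complex.exp (φ * Complex.I)) * hs
  have h1 : (Hadmat *ᵥ dvec φ - e0) 1 = ((Real.sin φ : ℝ) : ℂ) * (-Complex.I) := by
    simp [Hadmat, e0, dvec, Matrix.mulVec, dotProduct, Fin.sum_univ_two, Complex.sin]
    linear_combination (Complex.exp (-(φ * Complex.I)) - Complex.exp (φ * Complex.I)) * hs
      + (Complex.exp (-(φ * Complex.I)) - Complex.exp (φ * Complex.I)) / 2 * Complex.I_mul_I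
  rw [enormVec_sq, Fin.sum_univ_two, h0, h1, norm_mul, norm_neg, Complex.norm_I,
    Complex.norm_real, Complex.norm_real, mul_one, Real.norm_eq_abs, Real.norm_eq_abs,
    sq_abs, sq_abs]
  nlinarith [Real.sin_sq_add_cos_sq φ, Real.neg_one_le_cos φ]

lemma tens_add {α β : Type*} (u : α → ℂ) (v w : β → ℂ) :
    tens u (v - w) = tens u v - tens u w := by
  ext p; simp [tens, mul_sub]

lemma V_tens (φ : ℝ) (nI nA : ℕ) (a₀ : Fin nA → ℂ) (ha₀ : enormVec a₀ = 1)
    (ψ : Fin 2 × Fin nI → ℂ) :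
    Vmat φ nI nA a₀ *ᵥ tens hvec (tens ψ a₀) = tens (dvec φ) (tens ψ a₀) := by
  rw [Vmat, Matrix.add_mulVec, Matrix.smul_mulVec, kron_tens, kron_tens, kron_tens, kron_tens,
    Matrix.sub_mulVec, projVec_self a₀ ha₀, diag_h]
  ext p; simp [tens]

lemma Y_tens (φ : ℝ) (nI nA : ℕ) (w : (Fin 2 × Fin nI) × Fin nA → ℂ) :
    Ymat φ nI nA *ᵥ tens (dvec φ) w =
      tens hvec (P1mat nI nA *ᵥ w) + tens (dvec φ) (P0mat nI nA *ᵥ w) := by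
  rw [Ymat, Matrix.add_mulVec, kron_tens, kron_tens, diag_d, Matrix.one_mulVec]
  rfl

/-- Accepting case of the NUSG QMA-completeness proof: if the verifier `U` accepts the
witness `ψ` (with ancillas in state `a₀`) with probability at least `1 − ε`, then
`Ψ = |0⟩ ⊗ ψ ⊗ a₀` is an approximate fixed vector of `Z`: `‖ZΨ − Ψ‖ ≤ 2√ε`. -/
theorem nusg_accepting_case (φ : ℝ) (hφ : φ ∈ Set.Ioc 0 (Real.pi / 4))
    (ε : ℝ) (hε : ε ∈ Set.Icc (0 : ℝ) 1) (nI nA : ℕ)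
    (a₀ : Fin nA → ℂ) (ha₀ : enormVec a₀ = 1)
    (U : Matrix ((Fin 2 × Fin nI) × Fin nA) ((Fin 2 × Fin nI) × Fin nA) ℂ)
    (hU : U ∈ Matrix.unitaryGroup ((Fin 2 × Fin nI) × Fin nA) ℂ)
    (ψ : Fin 2 × Fin nI → ℂ) (hψ : enormVec ψ = 1)
    (haccept :
      1 - ε ≤ enormVec ((P1mat nI nA).mulVec (U.mulVec (fun p => ψ p.1 * a₀ p.2))) ^ 2) :
    enormVec (fun p : Fin 2 × ((Fin 2 × Fin nI) × Fin nA) =>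
        (Zmat φ nI nA a₀ U).mulVec
          (fun q : Fin 2 × ((Fin 2 × Fin nI) × Fin nA) =>
            (if q.1 = 0 then 1 else 0) * ψ q.2.1 * a₀ q.2.2) p -
        (if p.1 = 0 then 1 else 0) * ψ p.2.1 * a₀ p.2.2) ≤ 2 * Real.sqrt ε := by
  have hU1 : Uᴴ * U = 1 := (Matrix.mem_unitaryGroup_iff' (A := U)).1 hU
  have hU2 : U * Uᴴ = 1 := (Matrix.mem_unitaryGroup_iff (A := U)).1 hU
  set x : (Fin 2 × Fin nI) × Fin nA → ℂ := tens ψ a₀ with hx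
  set y := Uᴴ *ᵥ (P0mat nI nA *ᵥ (U *ᵥ x)) with hy
  have hΨ : (fun q : Fin 2 × ((Fin 2 × Fin nI) × Fin nA) =>
      (if q.1 = 0 then 1 else 0) * ψ q.2.1 * a₀ q.2.2) = tens e0 x := by
    ext q; simp only [tens, e0, hx, mul_assoc]
  have hZ : Zmat φ nI nA a₀ U *ᵥ tens e0 x = tens e0 (x - y) + tens (Hadmat *ᵥ dvec φ) y := by
    simp only [Zmat, ← Matrix.mulVec_mulVec]
    rw [kron_tens, H_e0, Matrix.one_mulVec, hx, V_tens φ nI nA a₀ ha₀, ← hx, kron_tens,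
      Matrix.one_mulVec, Y_tens, Matrix.mulVec_add, Matrix.mulVec_add, kron_tens, kron_tens,
      kron_tens, kron_tens, Matrix.one_mulVec, Matrix.one_mulVec, Matrix.one_mulVec,
      Matrix.one_mulVec, H_h, P_add, Matrix.mulVec_sub, Matrix.mulVec_mulVec x, hU1,
      Matrix.one_mulVec]
  have hfin : (fun p : Fin 2 × ((Fin 2 × Fin nI) × Fin nA) =>
        (Zmat φ nI nA a₀ U).mulVec
          (fun q : Fin 2 × ((Fin 2 × Fin nI) × Fin nA) =>
            (if q.1 = 0 then 1 else 0) * ψ q.2.1 * a₀ q.2.2) p -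
        (if p.1 = 0 then 1 else 0) * ψ p.2.1 * a₀ p.2.2) =
      tens (Hadmat *ᵥ dvec φ - e0) y := by
    rw [hΨ, hZ]
    ext p
    have := congrFun hΨ p
    rw [this]
    simp only [tens, Pi.add_apply, Pi.sub_apply]
    ring
  rw [hfin]
  have hacc : 1 - ε ≤ enormVec (P1mat nI nA *ᵥ (U *ᵥ x)) ^ 2 := haccept
  have hyn : enormVec y ^ 2 ≤ ε := by
    rw [hy, enormVec_unitary _ (by rw [Matrix.conjTranspose_conjTranspose, hU2])]
    have h1 := P_norm nI nA (U *ᵥ x)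
    rw [enormVec_unitary U hU1, hx, enormVec_tens, hψ, ha₀, ← hx] at h1
    linarith
  apply abs_le_of_sq_le_sq' _ (by positivity) |>.2
  rw [enormVec_tens, mul_pow, Real.sq_sqrt hε.1]
  have := norm_final φ
  nlinarith [sq_nonneg (enormVec y)]
end

section
/- Fix φ ∈ (0, π/4] and ε ∈ [0, 1]. Let T = ℂ² (top ancilla qubit) with orthonormal basis |0⟩, |1⟩, let I = ℂ² ⊗ I′ (input register whose first factor is the accept qubit) and A (lower ancilla register) be finite-dimensional complex inner product spaces, with a distinguished unit vector a₀ ∈ A. Let U be a unitary on I ⊗ A, let P₁ = (|1⟩⟨1| ⊗ 1_{I′}) ⊗ 1_A, and let H be the Hadamard unitary on T. Define unitaries on T ⊗ I ⊗ A: V = diag(e^{−iφ}, e^{iφ}) ⊗ 1_I ⊗ |a₀⟩⟨a₀| + e^{2iφ}·(1_T ⊗ 1_I ⊗ (1_A − |a₀⟩⟨a₀|)); Y = diag(e^{iφ}, e^{−iφ}) ⊗ (|1⟩⟨1| ⊗ 1_{I′}) ⊗ 1_A + 1_T ⊗ (|0⟩⟨0| ⊗ 1_{I′}) ⊗ 1_A;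 and Z = (H ⊗ 1)(1_T ⊗ U*) Y (1_T ⊗ U) V (H ⊗ 1). If ‖P₁ U(ψ ⊗ a₀)‖² ≤ ε for every unit vector ψ ∈ I, then for every unit vector Φ ∈ T ⊗ I ⊗ A one has ‖Z Φ − Φ‖ ≥ sin φ − 2√ε; in particular every eigenvalue λ of Z satisfies |λ − 1| ≥ sin φ − 2√ε. -/
open Matrix Kronecker

noncomputable section

/-- Euclidean (ℓ²) norm of a finitely supported complex vector. -/
def l2enorm {ι : Type*} [Fintype ι] (v : ι → ℂ) : ℝ :=
  Real.sqrt (∑ i, ‖v i‖ ^ 2)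

end

theorem le_of_sq_le_sq_aux {x y : ℝ} (h : x ^ 2 ≤ y ^ 2) (hy : 0 ≤ y) : x ≤ y := by nlinarith [sq_nonneg (x - y), abs_le_of_sq_le_sq h hy, le_abs_self x]
theorem nusg_abs {E : Type*} [NormedAddCommGroup E] [InnerProductSpace ℂ E]
    (P Q : E →ₗ[ℂ] E) (hP : P.IsSymmetric) (hQ : Q.IsSymmetric)
    (hPP : ∀ x, P (P x) = P x) (hQQ : ∀ x, Q (Q x) = Q x)
    (s : ℝ) (hs : 0 ≤ s) (hQP : ∀ x, ‖Q (P x)‖ ≤ s * ‖P x‖)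
    (σ : ℝ) (hσ : 0 ≤ σ) (w u : ℂ) (hw : ‖w - 1‖ ≤ 1) (hw1 : σ ≤ ‖w - 1‖)
    (hg : ∀ b r : E, ∀ m : ℝ, 0 ≤ m → m ≤ ‖b‖ ^ 2 → inner ℂ b r = (m : ℂ) →
      σ * ‖b‖ ≤ ‖(u - 1) • b - (w - 1) • r‖)
    (a b : E) (ha : P a = a) (hb : P b = 0) :
    (σ - 2 * s) * ‖a + b‖ ≤ ‖(w - 1) • (a - Q a - Q b) + (u - 1) • b‖ := by
  have hab : inner ℂ a b = 0 := by rw [← ha, hP, hb, inner_zero_right]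
  have hpyth : ‖a + b‖ * ‖a + b‖ = ‖a‖ * ‖a‖ + ‖b‖ * ‖b‖ :=
    norm_add_sq_eq_norm_sq_add_norm_sq_of_inner_eq_zero a b hab
  have hale : ‖a‖ ≤ ‖a + b‖ := by
    refine le_of_sq_le_sq_aux ?_ (norm_nonneg _)
    nlinarith [mul_self_nonneg ‖b‖]
  have hble : ‖b‖ ≤ ‖a + b‖ := by
    refine le_of_sq_le_sq_aux ?_ (norm_nonneg _)
    nlinarith [mul_self_nonneg ‖a‖]
  have hQb : inner ℂ b (Q b) = ((‖Q b‖ ^ 2 : ℝ) : ℂ) := by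
    rw [← hQQ b, ← hQ, hQQ, inner_self_eq_norm_sq_to_K]; simp
  have hQble : ‖Q b‖ ≤ ‖b‖ := by
    have h1 : ‖Q b‖ ^ 2 ≤ ‖b‖ * ‖Q b‖ := by
      have := norm_inner_le_norm (𝕜 := ℂ) b (Q b)
      rw [hQb, Complex.norm_real, Real.norm_of_nonneg (by positivity)] at this
      exact this
    rcases (norm_nonneg (Q b)).eq_or_lt with h | h
    · rw [← h]; positivity
    · nlinarith
  have hPQ : ‖P (Q b)‖ ≤ s * ‖b‖ := by
    have h0 : inner ℂ (Q (P (Q b))) b = ((‖P (Q b)‖ ^ 2 : ℝ) : ℂ) := by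
      rw [hQ, ← hPP (Q b), hP, inner_self_eq_norm_sq_to_K]; simp [hPP]
    have h1 : ‖P (Q b)‖ ^ 2 ≤ s * ‖P (Q b)‖ * ‖b‖ := by
      have := norm_inner_le_norm (𝕜 := ℂ) (Q (P (Q b))) b
      rw [h0, Complex.norm_real, Real.norm_of_nonneg (by positivity)] at this
      exact this.trans (by gcongr; exact hQP _)
    rcases (norm_nonneg (P (Q b))).eq_or_lt with h | h
    · rw [← h]; positivity
    · nlinarith
  set g := (u - 1) • b - (w - 1) • (Q b - P (Q b)) with hgdef
  have hgn : σ * ‖b‖ ≤ ‖g‖ := by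
    apply hg b _ (‖Q b‖ ^ 2) (by positivity) (by gcongr)
    rw [inner_sub_right, hQb, ← hP, hb, inner_zero_left, sub_zero]
  have hPg : P g = 0 := by simp [hgdef, hb, hPP]
  have hag : inner ℂ ((w - 1) • a) g = 0 := by
    rw [inner_smul_left, ← ha, hP, hPg, inner_zero_right, mul_zero]
  have hpy2 := norm_add_sq_eq_norm_sq_add_norm_sq_of_inner_eq_zero _ _ hag
  have han : σ * ‖a‖ ≤ ‖(w - 1) • a‖ := by rw [norm_smul]; gcongr
  have hmain : σ * ‖a + b‖ ≤ ‖(w - 1) • a + g‖ := by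
    refine le_of_sq_le_sq_aux ?_ (norm_nonneg _)
    have h1 := mul_self_le_mul_self (by positivity) han
    have h2 := mul_self_le_mul_self (by positivity) hgn
    have h3 : (σ * ‖a + b‖) ^ 2 = σ * ‖a‖ * (σ * ‖a‖) + σ * ‖b‖ * (σ * ‖b‖) := by
      linear_combination σ ^ 2 * hpyth
    linarith [sq ‖(w - 1) • a + g‖]
  have hD : (w - 1) • (a - Q a - Q b) + (u - 1) • b
      = ((w - 1) • a + g) - ((w - 1) • (Q a + P (Q b))) := by
    rw [hgdef]; module
  have herr : ‖(w - 1) • (Q a + P (Q b))‖ ≤ 2 * s * ‖a + b‖ := by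
    rw [norm_smul]
    have h1 := hQP a
    rw [ha] at h1
    have h2 := norm_add_le (Q a) (P (Q b))
    have h3 : s * ‖a‖ ≤ s * ‖a + b‖ := by gcongr
    have h4 : s * ‖b‖ ≤ s * ‖a + b‖ := by gcongr
    have h5 : ‖w - 1‖ * ‖Q a + P (Q b)‖ ≤ 1 * ‖Q a + P (Q b)‖ := by gcongr
    linarith
  rw [hD]
  have := norm_sub_norm_le ((w - 1) • a + g) ((w - 1) • (Q a + P (Q b)))
  linarith

/-- version with the actual operator -/
theorem nusg_abs2 {E : Type*} [NormedAddCommGroup E] [InnerProductSpace ℂ E]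
    (P Q : E →ₗ[ℂ] E) (hP : P.IsSymmetric) (hQ : Q.IsSymmetric)
    (hPP : ∀ x, P (P x) = P x) (hQQ : ∀ x, Q (Q x) = Q x)
    (s : ℝ) (hs : 0 ≤ s) (hQP : ∀ x, ‖Q (P x)‖ ≤ s * ‖P x‖)
    (σ : ℝ) (hσ : 0 ≤ σ) (w u y : ℂ) (hyw : y * w = 1) (hy : ‖y‖ = 1)
    (hw : ‖w - 1‖ ≤ 1) (hw1 : σ ≤ ‖w - 1‖)
    (hg : ∀ b r : E, ∀ m : ℝ, 0 ≤ m → m ≤ ‖b‖ ^ 2 → inner ℂ b r = (m : ℂ) →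
      σ * ‖b‖ ≤ ‖(u - 1) • b - (w - 1) • r‖)
    (χ v : E) (hv : v = w • P χ + u • (χ - P χ)) :
    (σ - 2 * s) * ‖χ‖ ≤ ‖(v + (y - 1) • Q v) - χ‖ := by
  have key := nusg_abs P Q hP hQ hPP hQQ s hs hQP σ hσ w u hw hw1 hg (P χ) (χ - P χ)
    (hPP _) (by simp [hPP])
  rw [add_sub_cancel] at key
  refine key.trans (le_of_eq ?_)
  set d := (w - 1) • (P χ - Q (P χ) - Q (χ - P χ)) + (u - 1) • (χ - P χ) with hd
  have hd' : d = v - χ - (w - 1) • Q χ := by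
    rw [hd, hv, map_sub]; module
  have hB : (v + (y - 1) • Q v) - χ = (d - Q d) + y • Q d := by
    have : v = d + χ + (w - 1) • Q χ := by rw [hd']; abel
    rw [this]
    simp only [map_add, map_smul, hQQ]
    rw [← sub_eq_zero]
    trans (y * w - 1) • Q χ
    · module
    · rw [hyw, sub_self, zero_smul]
  rw [hB]
  have ho : inner ℂ (d - Q d) (Q d) = 0 := by
    rw [← hQ, map_sub, hQQ, sub_self, inner_zero_left]
  have h1 := norm_add_sq_eq_norm_sq_add_norm_sq_of_inner_eq_zero _ _ ho
  have h2 := norm_add_sq_eq_norm_sq_add_norm_sq_of_inner_eq_zero (d - Q d) (y • Q d)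
    (by rw [inner_smul_right, ho, mul_zero])
  rw [sub_add_cancel] at h1
  rw [norm_smul, hy, one_mul] at h2
  exact (mul_self_inj (norm_nonneg _) (norm_nonneg _)).1 (h1.trans h2.symm)

theorem nusg_g0 {E : Type*} [NormedAddCommGroup E] [InnerProductSpace ℂ E] (φ : ℝ)
    (h0 : 0 < φ) (h1 : φ ≤ Real.pi / 4) 
    (b r : E) (m : ℝ) (hm : 0 ≤ m) (hbr : inner ℂ b r = (m : ℂ)) :
    Real.sin φ * ‖b‖ ≤ ‖(Complex.exp (2 * (φ : ℂ) * Complex.I) - 1) • b -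
      (Complex.exp (-(φ : ℂ) * Complex.I) - 1) • r‖ := by
  have hs : 0 < Real.sin φ := Real.sin_pos_of_pos_of_lt_pi h0 (by linarith [Real.pi_pos])
  have hc : Real.cos (Real.pi / 3) ≤ Real.cos φ :=
    Real.cos_le_cos_of_nonneg_of_le_pi h0.le (by linarith [Real.pi_pos]) (by linarith [Real.pi_pos])
  rw [Real.cos_pi_div_three] at hc
  set g := (Complex.exp (2 * (φ : ℂ) * Complex.I) - 1) • b -
      (Complex.exp (-(φ : ℂ) * Complex.I) - 1) • r
  have e1 : (Complex.exp (2 * (φ : ℂ) * Complex.I)).im = Real.sin (2 * φ) := by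
    have := Complex.exp_ofReal_mul_I_im (2 * φ); push_cast at this; exact this
  have e2 : (Complex.exp (-(φ : ℂ) * Complex.I)).im = - Real.sin φ := by
    have := Complex.exp_ofReal_mul_I_im (-φ); push_cast at this; rw [this, Real.sin_neg]
  have him : (inner ℂ b g).im = Real.sin (2 * φ) * ‖b‖ ^ 2 + Real.sin φ * m := by
    simp only [g, inner_sub_right, inner_smul_right, hbr, inner_self_eq_norm_sq_to_K]
    have : ((‖b‖ : ℂ)) ^ 2 = ((‖b‖ ^ 2 : ℝ) : ℂ) := by push_cast; rfl
    simp only [Complex.coe_algebraMap, this, Complex.sub_im, Complex.im_mul_ofReal, e1, e2, Complex.one_im]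
    ring
  have h2 : (inner ℂ b g).im ≤ ‖b‖ * ‖g‖ :=
    (Complex.im_le_norm _).trans (norm_inner_le_norm b g)
  rw [him, Real.sin_two_mul] at h2
  rcases (norm_nonneg b).eq_or_lt with h | h
  · rw [← h]; simp
  · have h3 : Real.sin φ * ‖b‖^2 ≤ 2 * Real.sin φ * Real.cos φ * ‖b‖^2 := by
      gcongr; nlinarith
    have h4 : 0 ≤ Real.sin φ * m := by positivity
    nlinarith

theorem nusg_w (φ : ℝ) (h0 : 0 < φ) (h1 : φ ≤ Real.pi / 4) (w : ℂ)
    (hre : w.re = Real.cos φ) (him : w.im ^ 2 = Real.sin φ ^ 2) :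
    ‖w - 1‖ ≤ 1 ∧ Real.sin φ ≤ ‖w - 1‖ := by
  have hc : Real.cos (Real.pi / 3) ≤ Real.cos φ :=
    Real.cos_le_cos_of_nonneg_of_le_pi h0.le (by linarith [Real.pi_pos]) (by linarith [Real.pi_pos])
  rw [Real.cos_pi_div_three] at hc
  have hn : ‖w - 1‖ ^ 2 = (Real.cos φ - 1) ^ 2 + Real.sin φ ^ 2 := by
    rw [← Complex.normSq_eq_norm_sq, Complex.normSq_apply]; simp [hre]; nlinarith
  have := Real.sin_sq_add_cos_sq φ
  constructor
  · refine le_of_sq_le_sq_aux ?_ zero_le_one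
    nlinarith
  · refine le_of_sq_le_sq_aux ?_ (norm_nonneg _)
    nlinarith [sq_nonneg (Real.cos φ - 1)]

theorem nusg_g1 {E : Type*} [NormedAddCommGroup E] [InnerProductSpace ℂ E] (φ : ℝ)
    (h0 : 0 < φ) (h1 : φ ≤ Real.pi / 4) 
    (b r : E) (m : ℝ) (hm : m ≤ ‖b‖ ^ 2) (hbr : inner ℂ b r = (m : ℂ)) :
    Real.sin φ * ‖b‖ ≤ ‖(Complex.exp (2 * (φ : ℂ) * Complex.I) - 1) • b -
      (Complex.exp ((φ : ℂ) * Complex.I) - 1) • r‖ := by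
  have hc : 0 ≤ Real.cos φ :=
    Real.cos_nonneg_of_neg_pi_div_two_le_of_le (by linarith [Real.pi_pos]) (by linarith [Real.pi_pos])
  have hw := (nusg_w φ h0 h1 (Complex.exp ((φ : ℂ) * Complex.I))
    (Complex.exp_ofReal_mul_I_re φ) (by rw [Complex.exp_ofReal_mul_I_im φ])).2
  have hu : Complex.exp (2 * (φ : ℂ) * Complex.I) = Complex.exp ((φ : ℂ) * Complex.I) ^ 2 := by
    rw [← Complex.exp_nat_mul]; congr 1; push_cast; ring
  have hre := Complex.exp_ofReal_mul_I_re φ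
  have hn := Complex.norm_exp_ofReal_mul_I φ
  rw [hu]
  set w := Complex.exp ((φ : ℂ) * Complex.I)
  have : (w ^ 2 - 1) • b - (w - 1) • r = (w - 1) • (w • b + (b - r)) := by module
  rw [this, norm_smul]
  gcongr
  refine le_of_sq_le_sq_aux ?_ (norm_nonneg _)
  have h2 := norm_add_sq (𝕜 := ℂ) (w • b) (b - r)
  have h3 : RCLike.re (inner ℂ (w • b) (b - r)) = Real.cos φ * (‖b‖ ^ 2 - m) := by
    rw [inner_smul_left, inner_sub_right, hbr, inner_self_eq_norm_sq_to_K]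
    have : ((‖b‖ : ℂ)) ^ 2 - m = ((‖b‖ ^ 2 - m : ℝ) : ℂ) := by push_cast; rfl
    simp only [Complex.coe_algebraMap, this]
    simp only [RCLike.re_to_complex, Complex.re_mul_ofReal, Complex.conj_re, hre]
  rw [h3, norm_smul, hn, one_mul] at h2
  rw [h2]
  have : 0 ≤ Real.cos φ * (‖b‖ ^ 2 - m) := mul_nonneg hc (by linarith)
  nlinarith [sq_nonneg ‖b - r‖]

theorem l2enorm_eq {ι : Type*} [Fintype ι] (v : ι → ℂ) : l2enorm v = ‖WithLp.toLp 2 v‖ := by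
  rw [EuclideanSpace.norm_eq]; rfl

theorem l2enorm_sq {ι : Type*} [Fintype ι] (v : ι → ℂ) : l2enorm v ^ 2 = ∑ i, ‖v i‖ ^ 2 :=
  Real.sq_sqrt (by positivity)

theorem l2enorm_nonneg {ι : Type*} [Fintype ι] (v : ι → ℂ) : 0 ≤ l2enorm v := Real.sqrt_nonneg _

theorem l2enorm_sq' {ι : Type*} [Fintype ι] (v : ι → ℂ) :
    ((l2enorm v ^ 2 : ℝ) : ℂ) = star v ⬝ᵥ v := by
  rw [l2enorm_sq]; push_cast; simp only [dotProduct, Pi.star_apply]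
  refine Finset.sum_congr rfl fun i _ => ?_
  exact (Complex.conj_mul' _).symm

theorem l2enorm_mulVec {ι : Type*} [Fintype ι] [DecidableEq ι] (M : Matrix ι ι ℂ)
    (hM : Mᴴ * M = 1) (v : ι → ℂ) : l2enorm (M *ᵥ v) = l2enorm v := by
  have : l2enorm (M *ᵥ v) ^ 2 = l2enorm v ^ 2 := by
    have h : ((l2enorm (M *ᵥ v) ^ 2 : ℝ) : ℂ) = ((l2enorm v ^ 2 : ℝ) : ℂ) := by
      rw [l2enorm_sq', l2enorm_sq', star_mulVec, dotProduct_mulVec, vecMul_vecMul, hM, vecMul_one]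
    exact_mod_cast h
  exact (pow_left_inj₀ (l2enorm_nonneg _) (l2enorm_nonneg _) two_ne_zero).1 this

theorem l2enorm_smul {ι : Type*} [Fintype ι] (c : ℂ) (v : ι → ℂ) :
    l2enorm (c • v) = ‖c‖ * l2enorm v := by
  rw [l2enorm_eq, l2enorm_eq, WithLp.toLp_smul, norm_smul]

theorem l2enorm_slice {κ : Type*} [Fintype κ] (v : Fin 2 × κ → ℂ) :
    l2enorm v ^ 2 = l2enorm (fun p => v (0, p)) ^ 2 + l2enorm (fun p => v (1, p)) ^ 2 := by
  simp only [l2enorm_sq, Fintype.sum_prod_type, Fin.sum_univ_two]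

theorem l2enorm_tensor {κ μ : Type*} [Fintype κ] [Fintype μ] (ψ : κ → ℂ) (a : μ → ℂ)
    (ha : l2enorm a = 1) : l2enorm (fun p : κ × μ => ψ p.1 * a p.2) = l2enorm ψ := by
  have h : l2enorm (fun p : κ × μ => ψ p.1 * a p.2) ^ 2 = l2enorm ψ ^ 2 * l2enorm a ^ 2 := by
    simp only [l2enorm_sq, Fintype.sum_prod_type, norm_mul, mul_pow, Finset.sum_mul_sum]
  rw [ha, one_pow, mul_one] at h
  exact (pow_left_inj₀ (l2enorm_nonneg _) (l2enorm_nonneg _) two_ne_zero).1 h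

theorem kron_diag_mulVec {κ : Type*} [Fintype κ] (d : Fin 2 → ℂ) (M : Matrix κ κ ℂ)
    (v : Fin 2 × κ → ℂ) (t : Fin 2) :
    (fun p => ((Matrix.diagonal d ⊗ₖ M) *ᵥ v) (t, p)) = d t • (M *ᵥ fun p => v (t, p)) := by
  funext p
  simp only [mulVec, dotProduct, Fintype.sum_prod_type, kroneckerMap_apply, Matrix.diagonal_apply,
    Pi.smul_apply, smul_eq_mul]
  rw [Finset.sum_eq_single t]
  · simp [Finset.mul_sum, mul_assoc]
  · intro s _ hs; simp [hs.symm]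
  · simp

theorem kron_one_mulVec {κ : Type*} [Fintype κ] (M : Matrix κ κ ℂ)
    (v : Fin 2 × κ → ℂ) (t : Fin 2) :
    (fun p => (((1 : Matrix (Fin 2) (Fin 2) ℂ) ⊗ₖ M) *ᵥ v) (t, p))
      = M *ᵥ fun p => v (t, p) := by
  rw [← Matrix.diagonal_one, kron_diag_mulVec, one_smul]

theorem Had_herm : Hadmatᴴ = Hadmat := by
  ext i j; fin_cases i <;> fin_cases j <;> simp [Hadmat]

theorem Had_mul : Hadmat * Hadmat = 1 := by
  have h : ((Real.sqrt 2 : ℝ) : ℂ)⁻¹ * ((Real.sqrt 2 : ℝ) : ℂ)⁻¹ = 1 / 2 := by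
    rw [← mul_inv, ← Complex.ofReal_mul, Real.mul_self_sqrt (by norm_num)]; norm_num
  ext i j; fin_cases i <;> fin_cases j <;>
    simp [Hadmat, Matrix.mul_apply, Fin.sum_univ_two, h] <;> norm_num

theorem HadK_mul (κ : Type*) [Fintype κ] [DecidableEq κ] :
    (Hadmat ⊗ₖ (1 : Matrix κ κ ℂ)) * (Hadmat ⊗ₖ (1 : Matrix κ κ ℂ)) = 1 := by
  rw [← mul_kronecker_mul, Had_mul, mul_one, one_kronecker_one]

theorem HadK_herm (κ : Type*) [Fintype κ] [DecidableEq κ] :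
    (Hadmat ⊗ₖ (1 : Matrix κ κ ℂ))ᴴ = (Hadmat ⊗ₖ (1 : Matrix κ κ ℂ)) := by
  rw [conjTranspose_kronecker, Had_herm, conjTranspose_one]

theorem P1_herm (nI nA : ℕ) : (P1mat nI nA)ᴴ = P1mat nI nA := by
  simp [P1mat, conjTranspose_kronecker]

theorem P1_mul (nI nA : ℕ) : P1mat nI nA * P1mat nI nA = P1mat nI nA := by
  simp [P1mat, ← mul_kronecker_mul]

theorem P0_eq (nI nA : ℕ) : ((Matrix.single (0 : Fin 2) (0 : Fin 2) (1 : ℂ) ⊗ₖ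
          (1 : Matrix (Fin nI) (Fin nI) ℂ)) ⊗ₖ (1 : Matrix (Fin nA) (Fin nA) ℂ))
    = 1 - P1mat nI nA := by
  rw [eq_sub_iff_add_eq, P1mat, ← add_kronecker, ← add_kronecker]
  have : Matrix.single (0 : Fin 2) (0 : Fin 2) (1 : ℂ) + Matrix.single 1 1 1 = 1 := by
    ext i j; fin_cases i <;> fin_cases j <;> simp
  rw [this, one_kronecker_one, one_kronecker_one]

theorem proj_herm {ι : Type*} (a : ι → ℂ) : (projVec a)ᴴ = projVec a := by
  ext i j; simp [projVec, mul_comm]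

theorem proj_mul {ι : Type*} [Fintype ι] (a : ι → ℂ) (ha : l2enorm a = 1) :
    projVec a * projVec a = projVec a := by
  have h := l2enorm_sq' a
  rw [ha] at h
  ext i j
  simp only [projVec, Matrix.mul_apply, Matrix.of_apply]
  have : ∀ x, a i * star (a x) * (a x * star (a j)) = (star (a x) * a x) * (a i * star (a j)) :=
    fun x => by ring
  simp only [this, ← Finset.sum_mul]
  simp only [dotProduct, Pi.star_apply] at h
  rw [← h]; simp

theorem proj_apply {κ μ : Type*} [Fintype κ] [Fintype μ] [DecidableEq κ] (a : μ → ℂ)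
    (x : κ × μ → ℂ) : ((1 : Matrix κ κ ℂ) ⊗ₖ projVec a) *ᵥ x =
      fun p => (∑ c, star (a c) * x (p.1, c)) * a p.2 := by
  funext p
  simp only [mulVec, dotProduct, Fintype.sum_prod_type, kroneckerMap_apply, Matrix.one_apply]
  rw [Finset.sum_eq_single p.1]
  · simp only [projVec, Matrix.of_apply, if_true, one_mul, Finset.sum_mul]
    exact Finset.sum_congr rfl fun c _ => by ring
  · intro s _ hs; simp [hs.symm]
  · simp

theorem reject_all (nI nA : ℕ) (ε : ℝ)
    (a₀ : Fin nA → ℂ) (ha₀ : l2enorm a₀ = 1)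
    (U : Matrix ((Fin 2 × Fin nI) × Fin nA) ((Fin 2 × Fin nI) × Fin nA) ℂ)
    (hreject : ∀ ψ : Fin 2 × Fin nI → ℂ, l2enorm ψ = 1 →
      l2enorm ((P1mat nI nA).mulVec (U.mulVec (fun p => ψ p.1 * a₀ p.2))) ^ 2 ≤ ε)
    (ψ : Fin 2 × Fin nI → ℂ) :
    l2enorm ((P1mat nI nA).mulVec (U.mulVec (fun p => ψ p.1 * a₀ p.2))) ≤
      Real.sqrt ε * l2enorm (fun p : (Fin 2 × Fin nI) × Fin nA => ψ p.1 * a₀ p.2) := by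
  rw [l2enorm_tensor _ _ ha₀]
  rcases (l2enorm_nonneg ψ).eq_or_lt with h | h
  · have h0 : ψ = 0 := by
      rw [l2enorm_eq] at h
      simpa using norm_eq_zero.1 h.symm
    subst h0
    rw [← h, mul_zero]
    have : (fun p : (Fin 2 × Fin nI) × Fin nA => (0 : Fin 2 × Fin nI → ℂ) p.1 * a₀ p.2) = 0 := by
      funext p; simp
    rw [this, mulVec_zero, mulVec_zero]
    simp [l2enorm]
  · have hc : l2enorm (((l2enorm ψ : ℂ))⁻¹ • ψ) = 1 := by
      rw [l2enorm_smul, norm_inv, Complex.norm_real, Real.norm_of_nonneg h.le,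
        inv_mul_cancel₀ h.ne']
    have h1 := hreject _ hc
    have h2 : (fun p : (Fin 2 × Fin nI) × Fin nA => (((l2enorm ψ : ℂ))⁻¹ • ψ) p.1 * a₀ p.2)
        = ((l2enorm ψ : ℂ))⁻¹ • (fun p => ψ p.1 * a₀ p.2) := by
      funext p; simp [mul_assoc]
    rw [h2, mulVec_smul, mulVec_smul] at h1
    have h3 := Real.le_sqrt_of_sq_le h1
    rw [l2enorm_smul, norm_inv, Complex.norm_real, Real.norm_of_nonneg h.le] at h3
    rwa [inv_mul_le_iff₀ h, mul_comm] at h3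

theorem nusg_mat {ι : Type*} [Fintype ι] [DecidableEq ι] (Pm Qm : Matrix ι ι ℂ)
    (hPh : Pmᴴ = Pm) (hQh : Qmᴴ = Qm) (hPP : Pm * Pm = Pm) (hQQ : Qm * Qm = Qm)
    (s : ℝ) (hs : 0 ≤ s) (hQP : ∀ x, l2enorm (Qm *ᵥ (Pm *ᵥ x)) ≤ s * l2enorm (Pm *ᵥ x))
    (σ : ℝ) (hσ : 0 ≤ σ) (w u y : ℂ) (hyw : y * w = 1) (hy : ‖y‖ = 1)
    (hw : ‖w - 1‖ ≤ 1) (hw1 : σ ≤ ‖w - 1‖)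
    (hg : ∀ b r : EuclideanSpace ℂ ι, ∀ m : ℝ, 0 ≤ m → m ≤ ‖b‖ ^ 2 →
      inner ℂ b r = (m : ℂ) → σ * ‖b‖ ≤ ‖(u - 1) • b - (w - 1) • r‖)
    (χ v : ι → ℂ) (hv : v = w • (Pm *ᵥ χ) + u • (χ - Pm *ᵥ χ)) :
    (σ - 2 * s) * l2enorm χ ≤ l2enorm ((v + (y - 1) • Qm *ᵥ v) - χ) := by
  have h1 : ∀ x, (Matrix.toEuclideanLin Pm) x = WithLp.toLp 2 (Pm *ᵥ x.ofLp) := fun x => rfl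
  have h2 : ∀ x, (Matrix.toEuclideanLin Qm) x = WithLp.toLp 2 (Qm *ᵥ x.ofLp) := fun x => rfl
  have key := nusg_abs2 (Matrix.toEuclideanLin Pm) (Matrix.toEuclideanLin Qm)
    (Matrix.isSymmetric_toEuclideanLin_iff.2 hPh) (Matrix.isSymmetric_toEuclideanLin_iff.2 hQh)
    (fun x => by rw [h1, h1]; simp only [mulVec_mulVec, hPP])
    (fun x => by rw [h2, h2]; simp only [mulVec_mulVec, hQQ])
    s hs (fun x => by rw [h1, h2, ← l2enorm_eq, ← l2enorm_eq]; exact hQP _)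
    σ hσ w u y hyw hy hw hw1 hg (WithLp.toLp 2 χ) (WithLp.toLp 2 v)
    (by rw [hv, h1]; rfl)
  rw [l2enorm_eq, l2enorm_eq]
  rw [h2] at key
  exact key

theorem slice_bound (nI nA : ℕ) (ε : ℝ)
    (a₀ : Fin nA → ℂ) (ha₀ : l2enorm a₀ = 1)
    (U : Matrix ((Fin 2 × Fin nI) × Fin nA) ((Fin 2 × Fin nI) × Fin nA) ℂ)
    (hU : U ∈ Matrix.unitaryGroup ((Fin 2 × Fin nI) × Fin nA) ℂ)
    (hreject : ∀ ψ : Fin 2 × Fin nI → ℂ, l2enorm ψ = 1 →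
      l2enorm ((P1mat nI nA).mulVec (U.mulVec (fun p => ψ p.1 * a₀ p.2))) ^ 2 ≤ ε)
    (σ : ℝ) (hσ : 0 ≤ σ) (w u y : ℂ) (hyw : y * w = 1) (hy : ‖y‖ = 1)
    (hw : ‖w - 1‖ ≤ 1) (hw1 : σ ≤ ‖w - 1‖)
    (hg : ∀ b r : EuclideanSpace ℂ ((Fin 2 × Fin nI) × Fin nA), ∀ m : ℝ, 0 ≤ m → m ≤ ‖b‖ ^ 2 →
      inner ℂ b r = (m : ℂ) → σ * ‖b‖ ≤ ‖(u - 1) • b - (w - 1) • r‖)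
    (χ v : (Fin 2 × Fin nI) × Fin nA → ℂ)
    (hv : v = w • (((1 : Matrix (Fin 2 × Fin nI) (Fin 2 × Fin nI) ℂ) ⊗ₖ projVec a₀) *ᵥ χ) +
      u • (χ - ((1 : Matrix (Fin 2 × Fin nI) (Fin 2 × Fin nI) ℂ) ⊗ₖ projVec a₀) *ᵥ χ)) :
    (σ - 2 * Real.sqrt ε) * l2enorm χ ≤
      l2enorm ((v + (y - 1) • (Uᴴ * P1mat nI nA * U) *ᵥ v) - χ) := by
  have hUU : Uᴴ * U = 1 := Matrix.mem_unitaryGroup_iff'.1 hU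
  have hUU' : U * Uᴴ = 1 := Matrix.mem_unitaryGroup_iff.1 hU
  set Pm := ((1 : Matrix (Fin 2 × Fin nI) (Fin 2 × Fin nI) ℂ) ⊗ₖ projVec a₀) with hPm
  have hPh : Pmᴴ = Pm := by rw [hPm, conjTranspose_kronecker, proj_herm, conjTranspose_one]
  have hPP : Pm * Pm = Pm := by rw [hPm, ← mul_kronecker_mul, proj_mul _ ha₀, mul_one]
  have hQh : (Uᴴ * P1mat nI nA * U)ᴴ = Uᴴ * P1mat nI nA * U := by
    simp [conjTranspose_mul, P1_herm, Matrix.mul_assoc]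
  have hQQ : (Uᴴ * P1mat nI nA * U) * (Uᴴ * P1mat nI nA * U) = Uᴴ * P1mat nI nA * U := by
    calc _ = Uᴴ * P1mat nI nA * (U * Uᴴ) * P1mat nI nA * U := by simp only [Matrix.mul_assoc]
      _ = _ := by rw [hUU', Matrix.mul_one, Matrix.mul_assoc Uᴴ, P1_mul]
  refine nusg_mat Pm _ hPh hQh hPP hQQ (Real.sqrt ε) (Real.sqrt_nonneg _) (fun x => ?_)
    σ hσ w u y hyw hy hw hw1 hg χ v hv
  rw [Matrix.mul_assoc, ← mulVec_mulVec,
    l2enorm_mulVec _ (by rwa [conjTranspose_conjTranspose]), ← mulVec_mulVec, hPm, proj_apply]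
  exact reject_all nI nA ε a₀ ha₀ U hreject (fun i => ∑ c, star (a₀ c) * x (i, c))

theorem Z_bound (φ : ℝ) (hφ : φ ∈ Set.Ioc 0 (Real.pi / 4))
    (ε : ℝ) (nI nA : ℕ)
    (a₀ : Fin nA → ℂ) (ha₀ : l2enorm a₀ = 1)
    (U : Matrix ((Fin 2 × Fin nI) × Fin nA) ((Fin 2 × Fin nI) × Fin nA) ℂ)
    (hU : U ∈ Matrix.unitaryGroup ((Fin 2 × Fin nI) × Fin nA) ℂ)
    (hreject : ∀ ψ : Fin 2 × Fin nI → ℂ, l2enorm ψ = 1 →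
      l2enorm ((P1mat nI nA).mulVec (U.mulVec (fun p => ψ p.1 * a₀ p.2))) ^ 2 ≤ ε)
    (Φ : Fin 2 × ((Fin 2 × Fin nI) × Fin nA) → ℂ) (hΦ : l2enorm Φ = 1) :
      Real.sin φ - 2 * Real.sqrt ε ≤
        l2enorm ((Zmat φ nI nA a₀ U) *ᵥ Φ - Φ) := by
  obtain ⟨h0, h1⟩ := hφ
  have hs : 0 < Real.sin φ := Real.sin_pos_of_pos_of_lt_pi h0 (by linarith [Real.pi_pos])
  have hUU : Uᴴ * U = 1 := Matrix.mem_unitaryGroup_iff'.1 hU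
  set W := (Hadmat ⊗ₖ (1 : Matrix ((Fin 2 × Fin nI) × Fin nA) ((Fin 2 × Fin nI) × Fin nA) ℂ))
    with hW
  have hWW : W * W = 1 := HadK_mul _
  have hWh : Wᴴ * W = 1 := by rw [hW, HadK_herm, ← hW, hWW]
  set X := ((1 : Matrix (Fin 2) (Fin 2) ℂ) ⊗ₖ Uᴴ) * Ymat φ nI nA *
    ((1 : Matrix (Fin 2) (Fin 2) ℂ) ⊗ₖ U) * Vmat φ nI nA a₀ with hX
  have hZ : Zmat φ nI nA a₀ U = W * X * W := by
    rw [Zmat, hX]; simp only [Matrix.mul_assoc, hW]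
  set Ξ := W *ᵥ Φ with hΞ
  have hΞn : l2enorm Ξ = 1 := by rw [hΞ, l2enorm_mulVec _ hWh, hΦ]
  have hred : l2enorm ((Zmat φ nI nA a₀ U) *ᵥ Φ - Φ) = l2enorm (X *ᵥ Ξ - Ξ) := by
    rw [← l2enorm_mulVec W hWh (X *ᵥ Ξ - Ξ), hΞ, mulVec_sub, mulVec_mulVec, mulVec_mulVec,
      mulVec_mulVec, hWW, one_mulVec, hZ]
  rw [hred]
  clear_value Ξ
  -- the slices of `X`
  set Pm := ((1 : Matrix (Fin 2 × Fin nI) (Fin 2 × Fin nI) ℂ) ⊗ₖ projVec a₀) with hPm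
  have hVs : ∀ t : Fin 2, (fun p => (Vmat φ nI nA a₀ *ᵥ Ξ) (t, p)) =
      (if t = 0 then Complex.exp (-(φ : ℂ) * Complex.I) else Complex.exp ((φ : ℂ) * Complex.I)) •
        (Pm *ᵥ fun p => Ξ (t, p)) + Complex.exp (2 * (φ : ℂ) * Complex.I) •
        ((fun p => Ξ (t, p)) - Pm *ᵥ fun p => Ξ (t, p)) := by
    intro t
    have e1 := kron_diag_mulVec (fun t => if t = 0 then Complex.exp (-(φ : ℂ) * Complex.I)
      else Complex.exp ((φ : ℂ) * Complex.I)) Pm Ξ t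
    have e2 := kron_one_mulVec ((1 : Matrix (Fin 2 × Fin nI) (Fin 2 × Fin nI) ℂ) ⊗ₖ
          ((1 : Matrix (Fin nA) (Fin nA) ℂ) - projVec a₀)) Ξ t
    have e3 : ((1 : Matrix (Fin 2 × Fin nI) (Fin 2 × Fin nI) ℂ) ⊗ₖ
          ((1 : Matrix (Fin nA) (Fin nA) ℂ) - projVec a₀)) = 1 - Pm := by
      rw [eq_sub_iff_add_eq, hPm, ← kronecker_add, sub_add_cancel, one_kronecker_one]
    rw [e3, sub_mulVec, one_mulVec] at e2
    rw [← e1, ← e2]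
    funext p
    simp only [Vmat, diag2, add_mulVec, smul_mulVec, Pi.add_apply, Pi.smul_apply, e3]
    rfl
  have hYs : ∀ (Θ : Fin 2 × ((Fin 2 × Fin nI) × Fin nA) → ℂ) (t : Fin 2),
      (fun p => (Ymat φ nI nA *ᵥ Θ) (t, p)) =
      (fun p => Θ (t, p)) + ((if t = 0 then Complex.exp ((φ : ℂ) * Complex.I)
        else Complex.exp (-(φ : ℂ) * Complex.I)) - 1) • (P1mat nI nA *ᵥ fun p => Θ (t, p)) := by
    intro Θ t
    have e1 := kron_diag_mulVec (fun t => if t = 0 then Complex.exp ((φ : ℂ) * Complex.I)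
      else Complex.exp (-(φ : ℂ) * Complex.I)) (P1mat nI nA) Θ t
    have e2 := kron_one_mulVec (1 - P1mat nI nA) Θ t
    rw [sub_mulVec, one_mulVec] at e2
    rw [sub_smul, one_smul, ← e1, add_sub, add_comm, ← add_sub, ← e2]
    funext p
    simp only [Ymat, P0_eq, diag2, add_mulVec, Pi.add_apply]
    rfl
  have hXs : ∀ t : Fin 2, (fun p => (X *ᵥ Ξ - Ξ) (t, p)) =
      ((fun p => (Vmat φ nI nA a₀ *ᵥ Ξ) (t, p)) + ((if t = 0 then Complex.exp ((φ : ℂ) * Complex.I)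
        else Complex.exp (-(φ : ℂ) * Complex.I)) - 1) • (Uᴴ * P1mat nI nA * U) *ᵥ
          (fun p => (Vmat φ nI nA a₀ *ᵥ Ξ) (t, p))) - fun p => Ξ (t, p) := by
    intro t
    have e : (fun p => (X *ᵥ Ξ - Ξ) (t, p)) = (fun p => (X *ᵥ Ξ) (t, p)) - fun p => Ξ (t, p) := rfl
    rw [e]
    congr 1
    rw [hX, ← mulVec_mulVec, ← mulVec_mulVec, ← mulVec_mulVec, kron_one_mulVec, hYs,
      kron_one_mulVec, mulVec_add, mulVec_mulVec, hUU, one_mulVec, mulVec_smul, mulVec_mulVec,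
      mulVec_mulVec, Matrix.mul_assoc]
  have hexp : Complex.exp ((φ : ℂ) * Complex.I) * Complex.exp (-(φ : ℂ) * Complex.I) = 1 := by
    rw [← Complex.exp_add]; simp
  have hn1 := Complex.norm_exp_ofReal_mul_I φ
  have hn2 := Complex.norm_exp_ofReal_mul_I (-φ)
  push_cast at hn2
  have hw1 := nusg_w φ h0 h1 (Complex.exp ((φ : ℂ) * Complex.I))
    (Complex.exp_ofReal_mul_I_re φ) (by rw [Complex.exp_ofReal_mul_I_im φ])
  have hw0 := nusg_w φ h0 h1 (Complex.exp (-(φ : ℂ) * Complex.I))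
    (by have := Complex.exp_ofReal_mul_I_re (-φ); push_cast at this; rw [this, Real.cos_neg])
    (by have := Complex.exp_ofReal_mul_I_im (-φ); push_cast at this
        rw [this, Real.sin_neg, neg_sq])
  have b0 := slice_bound nI nA ε a₀ ha₀ U hU hreject (Real.sin φ) hs.le
    (Complex.exp (-(φ : ℂ) * Complex.I)) (Complex.exp (2 * (φ : ℂ) * Complex.I))
    (Complex.exp ((φ : ℂ) * Complex.I)) hexp hn1 hw0.1 hw0.2
    (fun b r m hm _ hbr => nusg_g0 φ h0 h1 b r m hm hbr)
    (fun p => Ξ (0, p)) (fun p => (Vmat φ nI nA a₀ *ᵥ Ξ) (0, p)) (by rw [hVs, if_pos rfl])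
  have b1 := slice_bound nI nA ε a₀ ha₀ U hU hreject (Real.sin φ) hs.le
    (Complex.exp ((φ : ℂ) * Complex.I)) (Complex.exp (2 * (φ : ℂ) * Complex.I))
    (Complex.exp (-(φ : ℂ) * Complex.I)) (by rw [mul_comm, hexp]) hn2 hw1.1 hw1.2
    (fun b r m _ hm hbr => nusg_g1 φ h0 h1 b r m hm hbr)
    (fun p => Ξ (1, p)) (fun p => (Vmat φ nI nA a₀ *ᵥ Ξ) (1, p))
    (by rw [hVs, if_neg one_ne_zero])
  have x0 := hXs 0
  rw [if_pos rfl] at x0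
  have x1 := hXs 1
  rw [if_neg one_ne_zero] at x1
  rw [← x0] at b0
  rw [← x1] at b1
  rcases le_or_gt (Real.sin φ - 2 * Real.sqrt ε) 0 with hneg | hpos
  · exact hneg.trans (l2enorm_nonneg _)
  · refine le_of_sq_le_sq_aux ?_ (l2enorm_nonneg _)
    have s1 := l2enorm_slice Ξ
    rw [hΞn] at s1
    rw [l2enorm_slice (X *ᵥ Ξ - Ξ)]
    have q0 := pow_le_pow_left₀ (mul_nonneg hpos.le (l2enorm_nonneg _)) b0 2
    have q1 := pow_le_pow_left₀ (mul_nonneg hpos.le (l2enorm_nonneg _)) b1 2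
    rw [mul_pow] at q0 q1
    have : (Real.sin φ - 2 * Real.sqrt ε) ^ 2 =
      (Real.sin φ - 2 * Real.sqrt ε) ^ 2 * l2enorm (fun p => Ξ (0, p)) ^ 2 +
      (Real.sin φ - 2 * Real.sqrt ε) ^ 2 * l2enorm (fun p => Ξ (1, p)) ^ 2 := by
      rw [← mul_add, ← s1]; ring
    linarith

/-- Rejecting case of the NUSG QMA-completeness proof: if the verifier `U` accepts every
witness with probability at most `ε`, then every unit vector `Φ` satisfies
`‖ZΦ − Φ‖ ≥ sin φ − 2√ε`; in particular every spectral value `λ` of `Z` satisfies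
`|λ − 1| ≥ sin φ − 2√ε`. -/
theorem nusg_rejecting_case (φ : ℝ) (hφ : φ ∈ Set.Ioc 0 (Real.pi / 4))
    (ε : ℝ) (hε : ε ∈ Set.Icc (0 : ℝ) 1) (nI nA : ℕ)
    (a₀ : Fin nA → ℂ) (ha₀ : l2enorm a₀ = 1)
    (U : Matrix ((Fin 2 × Fin nI) × Fin nA) ((Fin 2 × Fin nI) × Fin nA) ℂ)
    (hU : U ∈ Matrix.unitaryGroup ((Fin 2 × Fin nI) × Fin nA) ℂ)
    (hreject : ∀ ψ : Fin 2 × Fin nI → ℂ, l2enorm ψ = 1 →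
      l2enorm ((P1mat nI nA).mulVec (U.mulVec (fun p => ψ p.1 * a₀ p.2))) ^ 2 ≤ ε) :
    (∀ Φ : Fin 2 × ((Fin 2 × Fin nI) × Fin nA) → ℂ, l2enorm Φ = 1 →
      Real.sin φ - 2 * Real.sqrt ε ≤
        l2enorm (fun p => (Zmat φ nI nA a₀ U).mulVec Φ p - Φ p)) ∧
    (∀ lam ∈ spectrum ℂ (Zmat φ nI nA a₀ U),
      Real.sin φ - 2 * Real.sqrt ε ≤ ‖lam - 1‖) := by
  have main := Z_bound φ hφ ε nI nA a₀ ha₀ U hU hreject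
  refine ⟨fun Φ hΦ => main Φ hΦ, fun lam hlam => ?_⟩
  rw [spectrum.mem_iff, Matrix.isUnit_iff_isUnit_det, isUnit_iff_ne_zero, not_not] at hlam
  obtain ⟨v, hv0, hv⟩ := Matrix.exists_mulVec_eq_zero_iff.2 hlam
  rw [sub_mulVec, Algebra.algebraMap_eq_smul_one, smul_mulVec, one_mulVec, sub_eq_zero] at hv
  have h : 0 < l2enorm v := by
    rw [l2enorm_eq]; exact norm_pos_iff.2 (by simpa using hv0)
  have hc : l2enorm (((l2enorm v : ℂ))⁻¹ • v) = 1 := by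
    rw [l2enorm_smul, norm_inv, Complex.norm_real, Real.norm_of_nonneg h.le,
      inv_mul_cancel₀ h.ne']
  have h2 := main _ hc
  have h3 : Zmat φ nI nA a₀ U *ᵥ (((l2enorm v : ℂ))⁻¹ • v) - ((l2enorm v : ℂ))⁻¹ • v
      = (lam - 1) • (((l2enorm v : ℂ))⁻¹ • v) := by
    rw [mulVec_smul, ← hv]; module
  rwa [h3, l2enorm_smul, hc, mul_one] at h2
end
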